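/- arXiv:0710.3012 — 3 statements merged into one kernel-verified Lean document; each statement's English description precedes it below -/
import Mathlib

section
/- Let Π : ℝⁿ → Mₙ(ℝ) take values in antisymmetric matrices, let H, C̃ : ℝⁿ → ℝ be smooth with Π(x)·∇C̃(x) = 0 for all x, and let G(x) = ∇H(x)(∇H(x))ᵀ − ‖∇H(x)‖² Iₙ. Define the vector fields ξ_Π(x) = Π(x)·∇H(x) and ξ(x) = Π(x)·∇H(x) + G(x)·∇C̃(x). If x₀ ∈ ℝⁿ satisfies ξ(x₀) = 0, then ∇H(x₀) and ∇C̃(x₀) are linearly dependent and ξ_Π(x₀) = 0. -/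
open Matrix

/-- The gradient of a function on `ℝⁿ` (as `Fin n → ℝ`), given by its partial derivatives. -/
noncomputable def grad {n : ℕ} (f : (Fin n → ℝ) → ℝ) (x : Fin n → ℝ) : Fin n → ℝ :=
  fun i => fderiv ℝ f x (Pi.single i 1)

/-- The dissipation matrix `G(x) = ∇H(x)(∇H(x))ᵀ − ‖∇H(x)‖² Iₙ`. -/
noncomputable def Gmat {n : ℕ} (H : (Fin n → ℝ) → ℝ) (x : Fin n → ℝ) :
    Matrix (Fin n) (Fin n) ℝ :=
  Matrix.vecMulVec (grad H x) (grad H x) -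
    (∑ i, (grad H x i) ^ 2) • (1 : Matrix (Fin n) (Fin n) ℝ)

theorem Gmat_mulVec {n : ℕ} (H : (Fin n → ℝ) → ℝ) (x v : Fin n → ℝ) :
    Gmat H x *ᵥ v = (grad H x ⬝ᵥ v) • grad H x - (grad H x ⬝ᵥ grad H x) • v := by
  have hsq : ∑ i, grad H x i ^ 2 = grad H x ⬝ᵥ grad H x := by simp [dotProduct, sq]
  rw [Gmat, sub_mulVec, vecMulVec_mulVec, smul_mulVec, one_mulVec, hsq]
  simp

/-- The equality case of the Cauchy–Schwarz inequality for the dot product. -/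
theorem smul_sub_smul_eq_zero_of_dotProduct_eq_zero {ι : Type*} [Fintype ι] {a c : ι → ℝ}
    (h : c ⬝ᵥ ((a ⬝ᵥ c) • a - (a ⬝ᵥ a) • c) = 0) :
    (a ⬝ᵥ c) • a - (a ⬝ᵥ a) • c = 0 := by
  rw [← dotProduct_self_eq_zero]
  simp only [dotProduct_sub, sub_dotProduct, dotProduct_smul, smul_dotProduct, smul_eq_mul,
    dotProduct_comm c a] at h ⊢
  linear_combination (-(a ⬝ᵥ a)) * h

/-- Proposition 2.1: if `x₀` is an equilibrium of the metriplectic vector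
field `ξ = Π·∇H + G·∇C̃`, then `∇H(x₀)` and `∇C̃(x₀)` are linearly dependent and `x₀` is an
equilibrium of the Hamiltonian vector field `ξ_Π = Π·∇H`. -/
theorem equilibrium_of_metriplectic {n : ℕ}
    (P : (Fin n → ℝ) → Matrix (Fin n) (Fin n) ℝ)
    (H Ct : (Fin n → ℝ) → ℝ)
    (hH : ContDiff ℝ (⊤ : ℕ∞) H) (hCt : ContDiff ℝ (⊤ : ℕ∞) Ct)
    (hPanti : ∀ x, (P x)ᵀ = - P x)
    (hCas : ∀ x, (P x).mulVec (grad Ct x) = 0)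
    (x₀ : Fin n → ℝ)
    (hx₀ : (P x₀).mulVec (grad H x₀) + (Gmat H x₀).mulVec (grad Ct x₀) = 0) :
    ¬ LinearIndependent ℝ ![grad H x₀, grad Ct x₀] ∧
      (P x₀).mulVec (grad H x₀) = 0 := by
  have hperp : grad Ct x₀ ⬝ᵥ (P x₀) *ᵥ grad H x₀ = 0 := by
    have h : grad Ct x₀ ᵥ* P x₀ = 0 := by
      rw [← mulVec_transpose, hPanti, neg_mulVec, hCas, neg_zero]
    rw [dotProduct_mulVec, h, zero_dotProduct]
  rw [Gmat_mulVec] at hx₀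
  have hG : grad Ct x₀ ⬝ᵥ ((grad H x₀ ⬝ᵥ grad Ct x₀) • grad H x₀ -
      (grad H x₀ ⬝ᵥ grad H x₀) • grad Ct x₀) = 0 := by
    simpa [dotProduct_add, hperp] using congrArg (grad Ct x₀ ⬝ᵥ ·) hx₀
  have hzero := smul_sub_smul_eq_zero_of_dotProduct_eq_zero hG
  refine ⟨fun hli => ?_, by simpa [hzero] using hx₀⟩
  have hcoeff := (LinearIndependent.pair_iff.mp hli (grad H x₀ ⬝ᵥ grad Ct x₀)
    (-(grad H x₀ ⬝ᵥ grad H x₀)) (by rwa [neg_smul, ← sub_eq_add_neg])).2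
  exact hli.ne_zero 0 (dotProduct_self_eq_zero.mp (neg_eq_zero.mp hcoeff))
end

section
/- Let Π : ℝⁿ → Mₙ(ℝ) be smooth with antisymmetric values, let H, C̃ : ℝⁿ → ℝ be smooth with Π(x)·∇C̃(x) = 0 for all x, and let G(x) = ∇H(x)(∇H(x))ᵀ − ‖∇H(x)‖² Iₙ. Set H_φ = H + C̃. If x : ℝ → ℝⁿ is a differentiable curve solving ẋ(t) = Π(x(t))·∇H(x(t)) + G(x(t))·∇C̃(x(t)), then for all t, d/dt H_φ(x(t)) = ⟨∇C̃(x(t)), ∇H(x(t))⟩² − ‖∇C̃(x(t))‖² ‖∇H(x(t))‖² ≤ 0. -/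
open Matrix

theorem fderiv_apply_eq_grad_dotProduct {n : ℕ} (f : (Fin n → ℝ) → ℝ) (x v : Fin n → ℝ) :
    fderiv ℝ f x v = grad f x ⬝ᵥ v := by
  conv_lhs => rw [pi_eq_sum_univ' v, map_sum]
  refine Finset.sum_congr rfl fun i _ => ?_
  rw [map_smul, smul_eq_mul, mul_comm, grad]

/-- Chain rule along a curve, in terms of the gradient. -/
theorem HasDerivAt.comp_grad {n : ℕ} {f : (Fin n → ℝ) → ℝ} {x : ℝ → Fin n → ℝ}
    {v : Fin n → ℝ} {t : ℝ} (hf : DifferentiableAt ℝ f (x t)) (hx : HasDerivAt x v t) :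
    HasDerivAt (fun s => f (x s)) (grad f (x t) ⬝ᵥ v) t := by
  rw [← fderiv_apply_eq_grad_dotProduct]
  exact hf.hasFDerivAt.comp_hasDerivAt t hx

/-- An antisymmetric matrix satisfies `⟨u, A v⟩ = -⟨v, A u⟩`. -/
theorem dotProduct_mulVec_of_transpose_eq_neg {n : ℕ} {A : Matrix (Fin n) (Fin n) ℝ}
    (hA : Aᵀ = -A) (u v : Fin n → ℝ) : u ⬝ᵥ A *ᵥ v = -(v ⬝ᵥ A *ᵥ u) := by
  rw [dotProduct_mulVec, ← mulVec_transpose, hA, neg_mulVec, neg_dotProduct, dotProduct_comm]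

/-- Lyapunov computation in the proof of Theorem 3.2: along any solution of
the metriplectic system `ẋ = Π·∇H + G·∇C̃`, the augmented energy `H_φ = H + C̃` satisfies
`d/dt H_φ(x(t)) = ⟨∇C̃, ∇H⟩² − ‖∇C̃‖² ‖∇H‖² ≤ 0`. -/
theorem augmented_energy_dissipation {n : ℕ}
    (P : (Fin n → ℝ) → Matrix (Fin n) (Fin n) ℝ)
    (H Ct : (Fin n → ℝ) → ℝ)
    (hP : ∀ i j, ContDiff ℝ (⊤ : ℕ∞) (fun x => P x i j))
    (hPanti : ∀ x, (P x)ᵀ = - P x)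
    (hH : ContDiff ℝ (⊤ : ℕ∞) H) (hCt : ContDiff ℝ (⊤ : ℕ∞) Ct)
    (hCas : ∀ x, (P x).mulVec (grad Ct x) = 0)
    (x : ℝ → Fin n → ℝ)
    (hx : ∀ t, HasDerivAt x
      ((P (x t)).mulVec (grad H (x t)) + (Gmat H (x t)).mulVec (grad Ct (x t))) t)
    (t : ℝ) :
    deriv (fun s => H (x s) + Ct (x s)) t =
        (grad Ct (x t) ⬝ᵥ grad H (x t)) ^ 2 -
          (∑ i, (grad Ct (x t) i) ^ 2) * (∑ i, (grad H (x t) i) ^ 2) ∧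
      deriv (fun s => H (x s) + Ct (x s)) t ≤ 0 := by
  have hd := (HasDerivAt.comp_grad (hH.differentiable (by simp) (x t)) (hx t)).add
    (HasDerivAt.comp_grad (hCt.differentiable (by simp) (x t)) (hx t))
  have key : deriv (fun s => H (x s) + Ct (x s)) t =
      (grad Ct (x t) ⬝ᵥ grad H (x t)) ^ 2 -
        (∑ i, (grad Ct (x t) i) ^ 2) * (∑ i, (grad H (x t) i) ^ 2) := by
    have hHH := dotProduct_mulVec_of_transpose_eq_neg (hPanti (x t)) (grad H (x t)) (grad H (x t))
    have hCH := dotProduct_mulVec_of_transpose_eq_neg (hPanti (x t)) (grad Ct (x t)) (grad H (x t))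
    rw [hCas, dotProduct_zero, neg_zero] at hCH
    have hsq (v : Fin n → ℝ) : ∑ i, v i ^ 2 = v ⬝ᵥ v := by simp [dotProduct, sq]
    refine hd.deriv.trans ?_
    simp only [dotProduct_add, Gmat_mulVec, dotProduct_sub, dotProduct_smul, smul_eq_mul, hCH,
      hsq, dotProduct_comm (grad Ct (x t)) (grad H (x t))]
    linear_combination hHH / 2
  refine ⟨key, key.trans_le (sub_nonpos.2 ?_)⟩
  exact Finset.sum_mul_sq_le_sq_mul_sq _ _ _
end

section
/- Let I₁ > I₂ > I₃ > 0 and M₀ ∈ ℝ with 2M₀² > 1/I₁. On ℝ³ define H(x₁,x₂,x₃) = (1/2)(x₁²/I₁ + x₂²/I₂ + x₃²/I₃), C(x₁,x₂,x₃) = (1/2)(x₁² + x₂² + x₃²), φ(s) = (s − M₀²/2)² − s/I₁, and H_φ(x) = H(x) + φ(C(x)). Then ∇H_φ(M₀, 0, 0) = 0 and the Hessian matrix of H_φ at (M₀, 0, 0) is positive definite. -/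
open Matrix

/-- The Hessian matrix of second partial derivatives of `f` at `x`. -/
noncomputable def hess {n : ℕ} (f : (Fin n → ℝ) → ℝ) (x : Fin n → ℝ) :
    Matrix (Fin n) (Fin n) ℝ :=
  Matrix.of fun i j => fderiv ℝ (fun y => fderiv ℝ f y (Pi.single j 1)) x (Pi.single i 1)

/-- The partial derivatives of the augmented energy of the free rigid body. -/
theorem fderiv_augmentedEnergy_single (I₁ I₂ I₃ M₀ : ℝ) (x : Fin 3 → ℝ) (j : Fin 3) :
    fderiv ℝ (fun x : Fin 3 → ℝ =>
        (1/2) * ((x 0) ^ 2 / I₁ + (x 1) ^ 2 / I₂ + (x 2) ^ 2 / I₃) +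
          (((1/2) * ((x 0) ^ 2 + (x 1) ^ 2 + (x 2) ^ 2) - M₀ ^ 2 / 2) ^ 2 -
            ((1/2) * ((x 0) ^ 2 + (x 1) ^ 2 + (x 2) ^ 2)) / I₁)) x (Pi.single j 1) =
      x j * (![I₁⁻¹, I₂⁻¹, I₃⁻¹] j - I₁⁻¹ + ((x 0) ^ 2 + (x 1) ^ 2 + (x 2) ^ 2 - M₀ ^ 2)) := by
  have hp (i : Fin 3) := (hasFDerivAt_apply (𝕜 := ℝ) i x).pow 2
  have hC := (((hp 0).add (hp 1)).add (hp 2)).const_mul (1/2 : ℝ)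
  have hH := ((((hp 0).mul_const I₁⁻¹).add ((hp 1).mul_const I₂⁻¹)).add
    ((hp 2).mul_const I₃⁻¹)).const_mul (1/2 : ℝ)
  have h := hH.add (((hC.sub_const (M₀ ^ 2 / 2)).pow 2).sub (hC.mul_const I₁⁻¹))
  simp only [div_eq_mul_inv _ I₁, div_eq_mul_inv _ I₂, div_eq_mul_inv _ I₃]
  refine (congrArg (fun L => L (Pi.single j 1)) h.fderiv).trans ?_
  fin_cases j <;> simp <;> ring

/-- The partial derivatives at `(M₀, 0, 0)` of `x j * (a + (‖x‖² - M₀²))`, the form taken by the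
partial derivatives of the augmented energy. -/
theorem fderiv_mul_add_normSq_single (a M₀ : ℝ) (i j : Fin 3) :
    fderiv ℝ (fun x : Fin 3 → ℝ =>
        x j * (a + ((x 0) ^ 2 + (x 1) ^ 2 + (x 2) ^ 2 - M₀ ^ 2))) ![M₀, 0, 0] (Pi.single i 1) =
      if i = j then a + (if j = 0 then 2 * M₀ ^ 2 else 0) else 0 := by
  have hx (k : Fin 3) := hasFDerivAt_apply (𝕜 := ℝ) k (![M₀, 0, 0] : Fin 3 → ℝ)
  have hp (k : Fin 3) := (hx k).pow 2
  have h := (hx j).mul (((((hp 0).add (hp 1)).add (hp 2)).sub_const (M₀ ^ 2)).const_add a)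
  refine (congrArg (fun L => L (Pi.single i 1)) h.fderiv).trans ?_
  fin_cases i <;> fin_cases j <;> simp
  ring

/-- for the free rigid body with `I₁ > I₂ > I₃ > 0` and `2M₀² > 1/I₁`, the
augmented energy `H_φ = H + φ(C)` with `φ(s) = (s − M₀²/2)² − s/I₁` has a critical point
at `(M₀, 0, 0)` with positive definite Hessian there (energy-Casimir method). -/
theorem rigid_body_energy_casimir (I₁ I₂ I₃ M₀ : ℝ)
    (h12 : I₂ < I₁) (h23 : I₃ < I₂) (h3 : 0 < I₃)
    (hM₀ : 1 / I₁ < 2 * M₀ ^ 2) :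
    grad (fun x : Fin 3 → ℝ =>
        (1/2) * ((x 0) ^ 2 / I₁ + (x 1) ^ 2 / I₂ + (x 2) ^ 2 / I₃) +
          (((1/2) * ((x 0) ^ 2 + (x 1) ^ 2 + (x 2) ^ 2) - M₀ ^ 2 / 2) ^ 2 -
            ((1/2) * ((x 0) ^ 2 + (x 1) ^ 2 + (x 2) ^ 2)) / I₁))
      ![M₀, 0, 0] = 0 ∧
    (hess (fun x : Fin 3 → ℝ =>
        (1/2) * ((x 0) ^ 2 / I₁ + (x 1) ^ 2 / I₂ + (x 2) ^ 2 / I₃) +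
          (((1/2) * ((x 0) ^ 2 + (x 1) ^ 2 + (x 2) ^ 2) - M₀ ^ 2 / 2) ^ 2 -
            ((1/2) * ((x 0) ^ 2 + (x 1) ^ 2 + (x 2) ^ 2)) / I₁))
      ![M₀, 0, 0]).PosDef := by
  have hI₂ : 0 < I₂ := h3.trans h23
  have hI₁ : 0 < I₁ := hI₂.trans h12
  constructor
  · ext i
    rw [grad, fderiv_augmentedEnergy_single]
    fin_cases i <;> simp
  · have hess_eq : hess (fun x : Fin 3 → ℝ =>
        (1/2) * ((x 0) ^ 2 / I₁ + (x 1) ^ 2 / I₂ + (x 2) ^ 2 / I₃) +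
          (((1/2) * ((x 0) ^ 2 + (x 1) ^ 2 + (x 2) ^ 2) - M₀ ^ 2 / 2) ^ 2 -
            ((1/2) * ((x 0) ^ 2 + (x 1) ^ 2 + (x 2) ^ 2)) / I₁)) ![M₀, 0, 0] =
        Matrix.diagonal ![2 * M₀ ^ 2, I₂⁻¹ - I₁⁻¹, I₃⁻¹ - I₁⁻¹] := by
      ext i j
      simp only [hess, Matrix.of_apply, fderiv_augmentedEnergy_single,
        fderiv_mul_add_normSq_single]
      fin_cases i <;> fin_cases j <;> simp
    rw [hess_eq, Matrix.posDef_diagonal_iff]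
    intro i
    fin_cases i
    · exact (one_div_pos.2 hI₁).trans hM₀
    · exact sub_pos.2 (inv_strictAnti₀ hI₂ h12)
    · exact sub_pos.2 (inv_strictAnti₀ h3 (h23.trans h12))
end
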